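/- Let u be a Gaussian random vector in R^m with mean v and positive semidefinite covariance matrix Σ. Let ρ > 0 and 0 < β ≤ 1. If ‖v‖ + sqrt(λ_max(Σ)) · ( sqrt(2 log(1/β)) + sqrt(m) ) ≤ ρ, then P(‖u‖ ≤ ρ) ≥ 1 − β. -/

import Mathlib

open MeasureTheory ProbabilityTheory Matrix

/-- A measure `μ` on `ℝ^m` is the multivariate normal distribution with mean `v` and
covariance matrix `S` iff it is a probability measure and every linear functional
pushes it forward to the corresponding one-dimensional Gaussian. -/
def IsGaussianVec {m : ℕ} (μ : Measure (EuclideanSpace ℝ (Fin m)))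
    (v : EuclideanSpace ℝ (Fin m)) (S : Matrix (Fin m) (Fin m) ℝ) : Prop :=
  IsProbabilityMeasure μ ∧
  ∀ a : EuclideanSpace ℝ (Fin m),
    μ.map (fun x => ∑ i, a i * x i) =
      gaussianReal (∑ i, a i * v i) (Real.toNNReal (∑ i, ∑ j, a i * S i j * a j))

/-- The largest eigenvalue of a positive semidefinite real matrix. -/
noncomputable def lambdaMax {m : ℕ} (S : Matrix (Fin m) (Fin m) ℝ) (hS : S.PosSemidef) : ℝ :=
  ⨆ i, hS.isHermitian.eigenvalues i

open scoped RealInnerProductSpace MatrixOrder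

lemma integral_exp_mul_sq_gaussianReal {s : ℝ} (hs : s < 1 / 2) :
    ∫ x, Real.exp (s * x ^ 2) ∂(gaussianReal 0 1) = (√(1 - 2 * s))⁻¹ := by
  rw [integral_gaussianReal_eq_integral_smul one_ne_zero]
  have h (x : ℝ) : gaussianPDFReal 0 1 x • Real.exp (s * x ^ 2) =
      (√(2 * Real.pi))⁻¹ * Real.exp (-(1 / 2 - s) * x ^ 2) := by
    simp only [gaussianPDFReal, NNReal.coe_one, smul_eq_mul, mul_one, sub_zero]
    rw [mul_assoc, ← Real.exp_add]
    congr 2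
    ring
  have hs' : 0 < 1 - 2 * s := by linarith
  simp_rw [h]
  rw [integral_const_mul, integral_gaussian, ← Real.sqrt_inv, ← Real.sqrt_inv,
    ← Real.sqrt_mul (by positivity)]
  congr 1
  have : (1 : ℝ) / 2 - s ≠ 0 := by linarith
  field_simp

lemma mgf_norm_sq_stdGaussian {m : ℕ} {s : ℝ} (hs : s < 1 / 2) :
    mgf (fun z ↦ ‖z‖ ^ 2) (stdGaussian (EuclideanSpace ℝ (Fin m))) s =
      (√(1 - 2 * s))⁻¹ ^ m := by
  rw [mgf, ← map_pi_eq_stdGaussian, integral_map (by fun_prop) (by fun_prop)]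
  simp_rw [EuclideanSpace.real_norm_sq_eq, Finset.mul_sum, Real.exp_sum]
  rw [integral_fintype_prod_eq_prod (f := fun _ x ↦ Real.exp (s * x ^ 2))]
  simp [integral_exp_mul_sq_gaussianReal hs]

lemma stdGaussian_real_norm_ge_le {m : ℕ} (hm : 0 < m) {t : ℝ} (ht : 0 ≤ t) :
    (stdGaussian (EuclideanSpace ℝ (Fin m))).real {z | (√m + t) ^ 2 ≤ ‖z‖ ^ 2} ≤
      Real.exp (-(t ^ 2 / 2)) := by
  set a : ℝ := √m
  have ha0 : 0 < a := by positivity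
  have ham : a ^ 2 = m := Real.sq_sqrt (by positivity)
  set s : ℝ := (1 - (a / (a + t)) ^ 2) / 2 with hs
  have hq : 0 < a / (a + t) := by positivity
  have hq1 : a / (a + t) ≤ 1 := (div_le_one (by positivity)).2 (by linarith)
  have hs0 : 0 ≤ s := by rw [hs]; nlinarith
  have hs1 : s < 1 / 2 := by rw [hs]; nlinarith
  have hmgf := mgf_norm_sq_stdGaussian (m := m) hs1
  have hsq : √(1 - 2 * s) = a / (a + t) := by
    rw [show 1 - 2 * s = (a / (a + t)) ^ 2 by rw [hs]; ring, Real.sqrt_sq hq.le]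
  rw [hsq, inv_div] at hmgf
  refine (measure_ge_le_exp_mul_mgf _ hs0 (Integrable.of_integral_ne_zero ?_)).trans ?_
  · rw [mgf] at hmgf
    rw [hmgf]
    positivity
  · have hbound : ((a + t) / a) ^ m ≤ Real.exp (t * a) := by
      calc ((a + t) / a) ^ m ≤ Real.exp (t / a) ^ m := by
            gcongr
            have := Real.add_one_le_exp (t / a)
            rwa [add_div, div_self ha0.ne', add_comm]
        _ = Real.exp (t * a) := by
            rw [← Real.exp_nat_mul, ← ham]
            congr 1
            field_simp
    rw [hmgf]
    calc Real.exp (-s * (a + t) ^ 2) * ((a + t) / a) ^ m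
        ≤ Real.exp (-s * (a + t) ^ 2) * Real.exp (t * a) := by gcongr
      _ = Real.exp (-(t ^ 2 / 2)) := by
        rw [← Real.exp_add, hs]
        congr 1
        field_simp
        ring

lemma IsGaussianVec.eq_multivariateGaussian {m : ℕ} {μ : Measure (EuclideanSpace ℝ (Fin m))}
    {v : EuclideanSpace ℝ (Fin m)} {S : Matrix (Fin m) (Fin m) ℝ} (hS : S.PosSemidef)
    (h : IsGaussianVec μ v S) : μ = multivariateGaussian v S := by
  have := h.1
  refine Measure.ext_of_charFun (funext fun a ↦ ?_)
  have hinner (x : EuclideanSpace ℝ (Fin m)) : ⟪x, a⟫ = ∑ i, a i * x i := by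
    simp [PiLp.inner_apply]
  have hquad : ∑ i, ∑ j, a i * S i j * a j = a ⬝ᵥ S *ᵥ a := by
    simp [dotProduct, mulVec, Finset.mul_sum, mul_assoc]
  have hnonneg : 0 ≤ a ⬝ᵥ S *ᵥ a := by simpa using hS.dotProduct_mulVec_nonneg a
  have hchar : charFun μ a = charFun (μ.map fun x ↦ ∑ i, a i * x i) 1 := by
    rw [charFun_apply, charFun_apply, integral_map (by fun_prop) (by fun_prop)]
    simp [hinner]
  rw [hchar, h.2 a, charFun_gaussianReal, charFun_multivariateGaussian hS, real_inner_comm,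
    hinner, hquad]
  simp [hnonneg]

lemma norm_toEuclideanCLM_sqrt_le {m : ℕ} {S : Matrix (Fin m) (Fin m) ℝ} (hS : S.PosSemidef)
    (z : EuclideanSpace ℝ (Fin m)) :
    ‖toEuclideanCLM (𝕜 := ℝ) (CFC.sqrt S) z‖ ≤ √(lambdaMax S hS) * ‖z‖ := by
  have hle : S ≤ algebraMap ℝ _ (lambdaMax S hS) := by
    refine le_algebraMap_of_spectrum_le fun x hx ↦ ?_
    rw [hS.isHermitian.spectrum_real_eq_range_eigenvalues] at hx
    obtain ⟨i, rfl⟩ := hx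
    exact le_ciSup (Set.finite_range _).bddAbove i
  have hquad : z ⬝ᵥ S *ᵥ z ≤ lambdaMax S hS * ‖z‖ ^ 2 := by
    have := (Matrix.le_iff.1 hle).dotProduct_mulVec_nonneg z
    simp [sub_mulVec, Algebra.algebraMap_eq_smul_one, smul_mulVec] at this
    rw [EuclideanSpace.real_norm_sq_eq]
    simpa [dotProduct, sq] using this
  have hnorm : ‖toEuclideanCLM (𝕜 := ℝ) (CFC.sqrt S) z‖ ^ 2 = z ⬝ᵥ S *ᵥ z := by
    have hsa : IsSelfAdjoint (toEuclideanCLM (𝕜 := ℝ) (CFC.sqrt S)) :=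
      (CFC.sqrt_nonneg S).isSelfAdjoint.map _
    rw [← real_inner_self_eq_norm_sq, ← ContinuousLinearMap.adjoint_inner_right,
      hsa.adjoint_eq, ← ContinuousLinearMap.comp_apply, ← ContinuousLinearMap.mul_def, ← map_mul,
      CFC.sqrt_mul_sqrt_self _ hS.nonneg, inner_toEuclideanCLM]
  have h0 : 0 ≤ lambdaMax S hS := Real.iSup_nonneg fun i ↦ hS.eigenvalues_nonneg i
  refine le_of_pow_le_pow_left₀ two_ne_zero (by positivity) ?_
  rw [hnorm, mul_pow, Real.sq_sqrt h0]
  exact hquad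

theorem stmt_0 {m : ℕ} {Ω : Type*} [MeasurableSpace Ω] (P : Measure Ω) [IsProbabilityMeasure P]
    (u : Ω → EuclideanSpace ℝ (Fin m)) (hu : Measurable u)
    (v : EuclideanSpace ℝ (Fin m)) (S : Matrix (Fin m) (Fin m) ℝ) (hS : S.PosSemidef)
    (hG : IsGaussianVec (P.map u) v S)
    (ρ β : ℝ) (hρ : 0 < ρ) (hβ0 : 0 < β) (hβ1 : β ≤ 1)
    (hcon : ‖v‖ + Real.sqrt (lambdaMax S hS) *
      (Real.sqrt (2 * Real.log (1 / β)) + Real.sqrt m) ≤ ρ) :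
    1 - β ≤ (P {ω | ‖u ω‖ ≤ ρ}).toReal := by
  have hlaw := hG.eq_multivariateGaussian hS
  rcases Nat.eq_zero_or_pos m with rfl | hm
  · have : {ω | ‖u ω‖ ≤ ρ} = Set.univ := by
      ext ω
      simp [Subsingleton.elim (u ω) 0, hρ.le]
    simp [this, hβ0.le]
  set t := √(2 * Real.log (1 / β)) with ht
  have htβ : Real.exp (-(t ^ 2 / 2)) = β := by
    have hlog : 0 ≤ Real.log (1 / β) := Real.log_nonneg ((one_le_div hβ0).2 hβ1)
    rw [ht, Real.sq_sqrt (by positivity), mul_div_cancel_left₀ _ two_ne_zero, one_div,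
      Real.log_inv, neg_neg, Real.exp_log hβ0]
  have htail := stdGaussian_real_norm_ge_le hm (Real.sqrt_nonneg _ : 0 ≤ t)
  rw [htβ] at htail
  have hball : MeasurableSet {x : EuclideanSpace ℝ (Fin m) | ‖x‖ ≤ ρ} :=
    measurableSet_le (by fun_prop) (by fun_prop)
  have hP : P {ω | ‖u ω‖ ≤ ρ} = stdGaussian (EuclideanSpace ℝ (Fin m))
      {z | ‖v + toEuclideanCLM (𝕜 := ℝ) (CFC.sqrt S) z‖ ≤ ρ} := by
    rw [show {ω | ‖u ω‖ ≤ ρ} = u ⁻¹' {x | ‖x‖ ≤ ρ} from rfl, ← Measure.map_apply hu hball, hlaw,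
      multivariateGaussian, Measure.map_apply (by fun_prop) hball]
    rfl
  rw [hP, ← measureReal_def]
  have hmeas : MeasurableSet {z : EuclideanSpace ℝ (Fin m) | (√m + t) ^ 2 ≤ ‖z‖ ^ 2} :=
    measurableSet_le (by fun_prop) (by fun_prop)
  have hcompl := probReal_compl_eq_one_sub (μ := stdGaussian (EuclideanSpace ℝ (Fin m))) hmeas
  have hsub : {z : EuclideanSpace ℝ (Fin m) | (√m + t) ^ 2 ≤ ‖z‖ ^ 2}ᶜ ⊆
      {z | ‖v + toEuclideanCLM (𝕜 := ℝ) (CFC.sqrt S) z‖ ≤ ρ} := by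
    intro z hz
    have hz' : ‖z‖ ≤ t + √m := by
      have hlt : ‖z‖ ^ 2 < (√m + t) ^ 2 := not_le.1 hz
      have := lt_of_pow_lt_pow_left₀ 2 (by positivity) hlt
      linarith
    calc ‖v + toEuclideanCLM (𝕜 := ℝ) (CFC.sqrt S) z‖
        ≤ ‖v‖ + √(lambdaMax S hS) * ‖z‖ :=
          (norm_add_le _ _).trans (by gcongr; exact norm_toEuclideanCLM_sqrt_le hS z)
      _ ≤ ‖v‖ + √(lambdaMax S hS) * (t + √m) := by gcongr
      _ ≤ ρ := hcon
  have := measureReal_mono (μ := stdGaussian (EuclideanSpace ℝ (Fin m))) hsub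
  linarith
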